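/- Let x_1,...,x_n ∈ R^k and w_1,...,w_n ∈ R be fixed, and π uniform on S_n. Suppose n^{-1} Σ_i x_i = 0 and n^{-1} Σ_i w_i = 0 (centered), n^{-1} Σ_i x_i x_i' → Q positive definite, n^{-1} Σ_i w_i^2 → σ² > 0, and the (2+δ)-moment averages n^{-1}Σ_i ‖x_i‖^{2+δ} and n^{-1}Σ_i |w_i|^{2+δ} are bounded. Then n^{-1/2} Σ_{i=1}^n x_i w_{π(i)} converges in distribution (with respect to the permutation measure) to N(0, σ² Q). -/

import Mathlib

open Finset Matrix MeasureTheory ProbabilityTheory Filter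

/-- The law of a `k`-dimensional standard Gaussian vector (i.i.d. `N(0,1)` coordinates). -/
noncomputable def stdGaussianPi (k : ℕ) : Measure (Fin k → ℝ) :=
  Measure.pi fun _ => gaussianReal 0 1

section PermutationStatistic

open scoped BigOperators

variable {ι : Type*} [Fintype ι]

/-- The permutation statistic `∑ᵢ aᵢ b_{π(i)}`. -/
def permStat (a b : ι → ℝ) (π : Equiv.Perm ι) : ℝ := ∑ i, a i * b (π i)

/-- The decrease of `permStat a b` when `π` is precomposed with the transposition of `i`, `j`. -/
def swapDiff (a b : ι → ℝ) (π : Equiv.Perm ι) (i j : ι) : ℝ := (a i - a j) * (b (π i) - b (π j))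

lemma permStat_mul_swap [DecidableEq ι] (a b : ι → ℝ) (π : Equiv.Perm ι) (i j : ι) :
    permStat a b (π * Equiv.swap i j) = permStat a b π - swapDiff a b π i j := by
  rcases eq_or_ne i j with rfl | hij
  · simp [swapDiff, Equiv.swap_self, ← Equiv.Perm.one_def]
  · have h : ∑ k, a k * (b (π (Equiv.swap i j k)) - b (π k))
        = a i * (b (π j) - b (π i)) + a j * (b (π i) - b (π j)) := by
      rw [Fintype.sum_eq_add i j hij]
      · simp
      · rintro k ⟨hi, hj⟩
        simp [Equiv.swap_apply_of_ne_of_ne hi hj]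
    simp only [mul_sub, sum_sub_distrib] at h
    simp only [permStat, swapDiff, Equiv.Perm.mul_apply]
    linarith

lemma sum_swapDiff {a b : ι → ℝ} (ha : ∑ i, a i = 0) (hb : ∑ i, b i = 0) (π : Equiv.Perm ι) :
    ∑ i, ∑ j, swapDiff a b π i j = 2 * Fintype.card ι * permStat a b π := by
  have hb' : ∑ i, b (π i) = 0 := by rwa [Equiv.sum_comp π b]
  have h (i : ι) : ∑ j, swapDiff a b π i j
      = Fintype.card ι * (a i * b (π i)) + permStat a b π := by
    have (j : ι) : swapDiff a b π i j
        = a i * b (π i) - a i * b (π j) - b (π i) * a j + a j * b (π j) := by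
      simp only [swapDiff]; ring
    simp only [this, sum_add_distrib, sum_sub_distrib, ← mul_sum, ha, hb', sum_const, card_univ,
      nsmul_eq_mul, permStat]
    ring
  simp only [h, sum_add_distrib, ← mul_sum, sum_const, card_univ, nsmul_eq_mul]
  simp only [permStat]
  ring

lemma sum_swapDiff_sq {a b : ι → ℝ} (ha : ∑ i, a i = 0) (hb : ∑ i, b i = 0)
    (π : Equiv.Perm ι) :
    ∑ i, ∑ j, swapDiff a b π i j ^ 2
      = 2 * Fintype.card ι * permStat (fun i => a i ^ 2) (fun i => b i ^ 2) π
        + 2 * ((∑ i, a i ^ 2) * ∑ i, b i ^ 2) + 4 * permStat a b π ^ 2 := by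
  have hb' : ∑ i, b (π i) = 0 := by rwa [Equiv.sum_comp π b]
  have hb2 : ∑ i, b (π i) ^ 2 = ∑ i, b i ^ 2 := Equiv.sum_comp π fun i => b i ^ 2
  have h (i : ι) : ∑ j, swapDiff a b π i j ^ 2
      = Fintype.card ι * (a i ^ 2 * b (π i) ^ 2) + a i ^ 2 * ∑ j, b j ^ 2
        - 2 * a i * ∑ j, a j * b (π j) ^ 2 + 4 * (a i * b (π i)) * permStat a b π
        + b (π i) ^ 2 * ∑ j, a j ^ 2 - 2 * b (π i) * ∑ j, a j ^ 2 * b (π j)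
        + permStat (fun i => a i ^ 2) (fun i => b i ^ 2) π := by
    have (j : ι) : swapDiff a b π i j ^ 2
        = a i ^ 2 * b (π i) ^ 2 - 2 * a i ^ 2 * b (π i) * b (π j) + a i ^ 2 * b (π j) ^ 2
          - 2 * a i * b (π i) ^ 2 * a j + 4 * (a i * b (π i)) * (a j * b (π j))
          - 2 * a i * (a j * b (π j) ^ 2)
          + b (π i) ^ 2 * a j ^ 2 - 2 * b (π i) * (a j ^ 2 * b (π j)) + a j ^ 2 * b (π j) ^ 2 := by
      simp only [swapDiff]; ring
    simp only [this, sum_add_distrib, sum_sub_distrib, ← mul_sum, ha, hb', hb2, sum_const,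
      card_univ, nsmul_eq_mul, permStat]
    ring
  simp only [h, sum_add_distrib, sum_sub_distrib, ← mul_sum, ← sum_mul, ha, hb', hb2, sum_const,
    card_univ, nsmul_eq_mul]
  simp only [permStat]
  ring

/-- Stein's identity for the exchangeable pair obtained by composing with a transposition. -/
lemma sum_perm_stein [DecidableEq ι] {E : Type*} [AddCommGroup E] [Module ℝ E] {a b : ι → ℝ}
    (ha : ∑ i, a i = 0) (hb : ∑ i, b i = 0) (G : ℝ → E) :
    (4 * Fintype.card ι : ℝ) • ∑ π, permStat a b π • G (permStat a b π)
      = ∑ π, ∑ i, ∑ j, swapDiff a b π i j •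
          (G (permStat a b π) - G (permStat a b π - swapDiff a b π i j)) := by
  have hpair (i j : ι) : (2 : ℝ) • ∑ π, swapDiff a b π i j • G (permStat a b π)
      = ∑ π, swapDiff a b π i j •
          (G (permStat a b π) - G (permStat a b π - swapDiff a b π i j)) := by
    have h : ∑ π, swapDiff a b π i j • G (permStat a b π)
        = -∑ π, swapDiff a b π i j • G (permStat a b π - swapDiff a b π i j) := by
      rw [← Equiv.sum_comp (Equiv.mulRight (Equiv.swap i j)), ← sum_neg_distrib]
      refine sum_congr rfl fun π _ => ?_
      rw [Equiv.coe_mulRight, permStat_mul_swap, ← neg_smul]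
      congr 1
      simp only [swapDiff, Equiv.Perm.mul_apply, Equiv.swap_apply_left, Equiv.swap_apply_right]
      ring
    simp only [smul_sub, sum_sub_distrib]
    rw [two_smul]
    nth_rewrite 2 [h]
    abel
  have hsum : (4 * Fintype.card ι : ℝ) • ∑ π, permStat a b π • G (permStat a b π)
      = ∑ π, ∑ i, ∑ j, (2 : ℝ) • swapDiff a b π i j • G (permStat a b π) := by
    rw [smul_sum]
    refine sum_congr rfl fun π _ => ?_
    simp only [← smul_sum, ← sum_smul]
    rw [sum_swapDiff ha hb, smul_smul, smul_smul]
    congr 1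
    ring
  rw [hsum, sum_comm]
  conv_rhs => rw [sum_comm]
  refine sum_congr rfl fun i _ => ?_
  rw [sum_comm]
  conv_rhs => rw [sum_comm]
  exact sum_congr rfl fun j _ => by rw [← hpair, smul_sum]

lemma expect_perm_apply [DecidableEq ι] (f : ι → ℝ) (i : ι) :
    𝔼 π : Equiv.Perm ι, f (π i) = 𝔼 j, f j := by
  have : Nonempty ι := ⟨i⟩
  have h (j : ι) : 𝔼 π : Equiv.Perm ι, f (π j) = 𝔼 π : Equiv.Perm ι, f (π i) :=
    Fintype.expect_equiv (Equiv.mulRight (Equiv.swap i j)) _ _ fun π => by simp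
  calc 𝔼 π : Equiv.Perm ι, f (π i) = 𝔼 j, 𝔼 π : Equiv.Perm ι, f (π j) := by
        simp only [h, Fintype.expect_const]
    _ = 𝔼 π : Equiv.Perm ι, 𝔼 j, f (π j) := expect_comm _ _ _
    _ = 𝔼 π : Equiv.Perm ι, 𝔼 j, f j := by
        refine expect_congr rfl fun π _ => ?_
        exact Fintype.expect_equiv π _ _ fun _ => rfl
    _ = 𝔼 j, f j := Fintype.expect_const _

lemma expect_permStat [DecidableEq ι] (c d : ι → ℝ) :
    𝔼 π, permStat c d π = (∑ i, c i) * (∑ i, d i) / Fintype.card ι := by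
  simp only [permStat]
  rw [expect_sum_comm]
  simp only [← mul_expect, expect_perm_apply]
  rw [← sum_mul, Fintype.expect_eq_sum_div_card, mul_div_assoc]

/-- Hoeffding's variance formula. -/
lemma expect_permStat_sq [DecidableEq ι] {a b : ι → ℝ} (ha : ∑ i, a i = 0) (hb : ∑ i, b i = 0) :
    (Fintype.card ι - 1) * 𝔼 π, permStat a b π ^ 2 = (∑ i, a i ^ 2) * ∑ i, b i ^ 2 := by
  rcases isEmpty_or_nonempty ι with hι | hι
  · simp [permStat]
  have hn : (Fintype.card ι : ℝ) ≠ 0 := by simp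
  have h := sum_perm_stein ha hb (fun x : ℝ => x)
  simp only [smul_eq_mul, sub_sub_cancel, ← pow_two, sum_swapDiff_sq ha hb] at h
  have h2 := congrArg (· / (Fintype.card (Equiv.Perm ι) : ℝ)) h
  simp only [mul_div_assoc, ← Fintype.expect_eq_sum_div_card] at h2
  rw [expect_add_distrib, expect_add_distrib, Fintype.expect_const, ← mul_expect, ← mul_expect,
   
    expect_permStat] at h2
  field_simp at h2
  linarith

lemma expect_permStat_sq_le [DecidableEq ι] {a b : ι → ℝ} (ha : ∑ i, a i = 0)
    (hb : ∑ i, b i = 0) (hn : 2 ≤ Fintype.card ι) :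
    𝔼 π, permStat a b π ^ 2 ≤ 2 * ((∑ i, a i ^ 2) * ∑ i, b i ^ 2) / Fintype.card ι := by
  have hn' : (2 : ℝ) ≤ Fintype.card ι := by exact_mod_cast hn
  rw [le_div_iff₀ (by linarith), ← expect_permStat_sq ha hb]
  have : 0 ≤ 𝔼 π, permStat a b π ^ 2 := expect_nonneg fun _ _ => sq_nonneg _
  nlinarith

lemma expect_abs_le_sqrt {κ : Type*} [Fintype κ] [Nonempty κ] (f : κ → ℝ) :
    𝔼 x, |f x| ≤ √(𝔼 x, f x ^ 2) := by
  refine Real.le_sqrt_of_sq_le ?_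
  simpa using expect_mul_sq_le_sq_mul_sq univ (fun x => |f x|) (fun _ => (1 : ℝ))

lemma norm_one_sub_exp_sub_le (u : ℝ) :
    ‖1 - Complex.exp (Complex.I * (-u : ℝ)) - Complex.I * u‖ ≤ 2 * u ^ 2 := by
  rcases le_total |u| 1 with hu | hu
  · have h := Complex.norm_exp_sub_one_sub_id_le (x := Complex.I * (-u : ℝ)) (by simpa using hu)
    have h2 : ‖1 - Complex.exp (Complex.I * (-u : ℝ)) - Complex.I * u‖
        = ‖Complex.exp (Complex.I * (-u : ℝ)) - 1 - Complex.I * (-u : ℝ)‖ := by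
      rw [← norm_neg]
      congr 1
      push_cast
      ring
    rw [h2]
    refine h.trans ?_
    simp only [norm_mul, Complex.norm_I, one_mul, Complex.norm_real, Real.norm_eq_abs, abs_neg,
      sq_abs]
    nlinarith [sq_nonneg u]
  · have h := Real.norm_exp_I_mul_ofReal_sub_one_le (x := -u)
    rw [norm_sub_rev, Real.norm_eq_abs, abs_neg] at h
    have h2 : ‖Complex.I * (u : ℂ)‖ = |u| := by simp
    have h3 := norm_sub_le (1 - Complex.exp (Complex.I * (-u : ℝ))) (Complex.I * u)
    rw [h2] at h3
    nlinarith [sq_abs u]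

lemma abs_swapDiff_le {ι : Type*} {a b : ι → ℝ} {κ : ℝ} (hκ : ∀ i j, |a i * b j| ≤ κ)
    (π : Equiv.Perm ι) (i j : ι) : |swapDiff a b π i j| ≤ 4 * κ := by
  have h1 := abs_le.1 (hκ i (π i))
  have h2 := abs_le.1 (hκ i (π j))
  have h3 := abs_le.1 (hκ j (π i))
  have h4 := abs_le.1 (hκ j (π j))
  simp only [swapDiff]
  rw [abs_le]
  constructor <;> nlinarith

lemma sum_pow_mul_sum_pow_le {a b : ι → ℝ} {κ : ℝ} (hκ : ∀ i j, |a i * b j| ≤ κ) {m : ℕ}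
    (hm : Even m) :
    (∑ i, a i ^ m) * ∑ i, b i ^ m ≤ (Fintype.card ι : ℝ) ^ 2 * κ ^ m := by
  rw [sum_mul_sum]
  calc ∑ i, ∑ j, a i ^ m * b j ^ m ≤ ∑ _i : ι, ∑ _j : ι, κ ^ m := by
        refine sum_le_sum fun i _ => sum_le_sum fun j _ => ?_
        rw [← mul_pow, ← hm.pow_abs]
        exact pow_le_pow_left₀ (abs_nonneg _) (hκ i j) m
    _ = (Fintype.card ι : ℝ) ^ 2 * κ ^ m := by
        simp only [sum_const, card_univ, nsmul_eq_mul]; ring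

lemma sum_sub_mean_sq_le [Nonempty ι] (c : ι → ℝ) :
    ∑ i, (c i - (∑ j, c j) / Fintype.card ι) ^ 2 ≤ ∑ i, c i ^ 2 := by
  have hn : (0 : ℝ) < Fintype.card ι := by simp [Fintype.card_pos]
  have : ∑ i, (c i - (∑ j, c j) / Fintype.card ι) ^ 2
      = ∑ i, c i ^ 2 - (∑ j, c j) ^ 2 / Fintype.card ι := by
    simp only [sub_sq, sum_add_distrib, sum_sub_distrib, ← mul_sum, ← sum_mul, sum_const,
      card_univ, nsmul_eq_mul]
    field_simp
    ring
  rw [this]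
  have : 0 ≤ (∑ j, c j) ^ 2 / (Fintype.card ι : ℝ) := by positivity
  linarith

lemma sum_sub_mean [Nonempty ι] (c : ι → ℝ) :
    ∑ i, (c i - (∑ j, c j) / Fintype.card ι) = 0 := by
  simp only [sum_sub_distrib, sum_const, card_univ, nsmul_eq_mul]
  field_simp
  ring

lemma permStat_sub_mean [Nonempty ι] (c d : ι → ℝ) (π : Equiv.Perm ι) :
    permStat (fun i => c i - (∑ j, c j) / Fintype.card ι)
        (fun i => d i - (∑ j, d j) / Fintype.card ι) π
      = permStat c d π - (∑ i, c i) * (∑ i, d i) / Fintype.card ι := by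
  have hd : ∑ i, d (π i) = ∑ i, d i := Equiv.sum_comp π d
  simp only [permStat, sub_mul, mul_sub, sum_sub_distrib, ← mul_sum, ← sum_mul, hd, sum_const,
    card_univ, nsmul_eq_mul]
  field_simp
  ring

/-- Concentration of the conditional variance in Stein's identity. -/
lemma expect_abs_sum_swapDiff_sq_le [DecidableEq ι] {a b : ι → ℝ} (ha : ∑ i, a i = 0)
    (hb : ∑ i, b i = 0) (hn : 2 ≤ Fintype.card ι) {κ : ℝ} (hκ : ∀ i j, |a i * b j| ≤ κ) :
    𝔼 π, |(∑ i, ∑ j, swapDiff a b π i j ^ 2) / (4 * Fintype.card ι)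
        - (∑ i, a i ^ 2) * (∑ i, b i ^ 2) / Fintype.card ι|
      ≤ √(Fintype.card ι) * κ ^ 2 + 2 * κ ^ 2 := by
  have hn0 : 0 < Fintype.card ι := by omega
  have : Nonempty ι := Fintype.card_pos_iff.1 hn0
  have hn' : (0 : ℝ) < Fintype.card ι := by exact_mod_cast hn0
  set c : ι → ℝ := fun i => a i ^ 2 - (∑ j, a j ^ 2) / Fintype.card ι with hc
  set d : ι → ℝ := fun i => b i ^ 2 - (∑ j, b j ^ 2) / Fintype.card ι with hd
  have hle (π : Equiv.Perm ι) :
      |(∑ i, ∑ j, swapDiff a b π i j ^ 2) / (4 * Fintype.card ι)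
        - (∑ i, a i ^ 2) * (∑ i, b i ^ 2) / Fintype.card ι|
      ≤ 2⁻¹ * |permStat c d π| + (Fintype.card ι : ℝ)⁻¹ * permStat a b π ^ 2 := by
    have h := permStat_sub_mean (fun i => a i ^ 2) (fun i => b i ^ 2) π
    rw [sum_swapDiff_sq ha hb]
    have : (2 * Fintype.card ι * permStat (fun i => a i ^ 2) (fun i => b i ^ 2) π
        + 2 * ((∑ i, a i ^ 2) * ∑ i, b i ^ 2) + 4 * permStat a b π ^ 2) / (4 * Fintype.card ι)
        - (∑ i, a i ^ 2) * (∑ i, b i ^ 2) / Fintype.card ι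
        = 2⁻¹ * permStat c d π + (Fintype.card ι : ℝ)⁻¹ * permStat a b π ^ 2 := by
      rw [hc, hd, h]
      field_simp
      ring
    rw [this]
    refine (abs_add_le _ _).trans (le_of_eq ?_)
    rw [abs_mul, abs_of_pos (by norm_num : (0 : ℝ) < 2⁻¹), 
      abs_of_nonneg (a := (Fintype.card ι : ℝ)⁻¹ * _) (by positivity)]
  have hV : 𝔼 π, |permStat c d π| ≤ 2 * (√(Fintype.card ι) * κ ^ 2) := by
    refine (expect_abs_le_sqrt _).trans ?_
    refine Real.sqrt_le_iff.2 ⟨by positivity, ?_⟩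
    refine (expect_permStat_sq_le (sum_sub_mean _) (sum_sub_mean _) hn).trans ?_
    rw [div_le_iff₀ hn', mul_pow, mul_pow, Real.sq_sqrt hn'.le]
    have h1 := sum_sub_mean_sq_le fun i => a i ^ 2
    have h2 := sum_sub_mean_sq_le fun i => b i ^ 2
    have h3 := sum_pow_mul_sum_pow_le hκ (m := 4) (by decide)
    have h4 := mul_le_mul h1 h2 (by positivity) (by positivity)
    simp only [← pow_mul] at h4
    norm_num at h4
    have h5 : 0 ≤ (Fintype.card ι : ℝ) ^ 2 * κ ^ 4 := by positivity
    nlinarith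
  have hS : 𝔼 π, permStat a b π ^ 2 ≤ 2 * (Fintype.card ι * κ ^ 2) := by
    refine (expect_permStat_sq_le ha hb hn).trans ?_
    rw [div_le_iff₀ hn']
    have := sum_pow_mul_sum_pow_le hκ even_two
    nlinarith
  calc _ ≤ 𝔼 π, (2⁻¹ * |permStat c d π| + (Fintype.card ι : ℝ)⁻¹ * permStat a b π ^ 2) :=
        expect_le_expect fun π _ => hle π
    _ = 2⁻¹ * 𝔼 π, |permStat c d π| + (Fintype.card ι : ℝ)⁻¹ * 𝔼 π, permStat a b π ^ 2 := by
        rw [expect_add_distrib, mul_expect, mul_expect]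
    _ ≤ 2⁻¹ * (2 * (√(Fintype.card ι) * κ ^ 2))
        + (Fintype.card ι : ℝ)⁻¹ * (2 * (Fintype.card ι * κ ^ 2)) := by gcongr
    _ = _ := by field_simp

/-- The derivative of the characteristic function of `permStat` is close to that of a Gaussian. -/
lemma norm_expect_stein_le [DecidableEq ι] {a b : ι → ℝ} (ha : ∑ i, a i = 0)
    (hb : ∑ i, b i = 0) (hn : 2 ≤ Fintype.card ι) {κ : ℝ} (hκ : ∀ i j, |a i * b j| ≤ κ)
    {s : ℝ} (hs0 : 0 ≤ s) (hs1 : s ≤ 1) :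
    ‖𝔼 π, (Complex.I * permStat a b π * Complex.exp (Complex.I * (s * permStat a b π : ℝ)))
        + ((∑ i, a i ^ 2) * (∑ i, b i ^ 2) / Fintype.card ι * s : ℝ)
          * 𝔼 π, Complex.exp (Complex.I * (s * permStat a b π : ℝ))‖
      ≤ 32 * Fintype.card ι * κ ^ 3 + (√(Fintype.card ι) * κ ^ 2 + 2 * κ ^ 2) := by
  have hn0 : 0 < Fintype.card ι := by omega
  have : Nonempty ι := Fintype.card_pos_iff.1 hn0
  have hn' : (0 : ℝ) < Fintype.card ι := by exact_mod_cast hn0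
  have hnC : (Fintype.card ι : ℂ) ≠ 0 := by exact_mod_cast hn'.ne'
  have hκ0 : 0 ≤ κ := (abs_nonneg _).trans (hκ (Classical.arbitrary ι) (Classical.arbitrary ι))
  set v : ℝ := (∑ i, a i ^ 2) * (∑ i, b i ^ 2) / Fintype.card ι with hv
  set e : ℝ → ℂ := fun x => Complex.exp (Complex.I * (s * x : ℝ)) with he
  have hstein : 𝔼 π, ((permStat a b π : ℝ) : ℂ) * e (permStat a b π)
      = 𝔼 π, (4 * Fintype.card ι : ℂ)⁻¹ * ∑ i, ∑ j, (swapDiff a b π i j : ℂ)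
        * (e (permStat a b π) - e (permStat a b π - swapDiff a b π i j)) := by
    have h := sum_perm_stein ha hb e
    simp only [Complex.real_smul] at h
    rw [← mul_expect, Fintype.expect_eq_sum_div_card, Fintype.expect_eq_sum_div_card, ← h]
    push_cast
    field_simp
  have hexp (x d : ℝ) : e (x - d) = e x * Complex.exp (Complex.I * (-(s * d) : ℝ)) := by
    simp only [he, ← Complex.exp_add]
    congr 1
    push_cast
    ring
  set r : ℝ → ℂ := fun u => 1 - Complex.exp (Complex.I * (-u : ℝ)) - Complex.I * u with hr
  set V : Equiv.Perm ι → ℝ := fun π => (∑ i, ∑ j, swapDiff a b π i j ^ 2) / (4 * Fintype.card ι)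
    with hV
  have hmain : 𝔼 π, (Complex.I * permStat a b π * e (permStat a b π))
        + (v * s : ℝ) * 𝔼 π, e (permStat a b π)
      = 𝔼 π, e (permStat a b π) * (Complex.I * (4 * Fintype.card ι : ℂ)⁻¹
          * ∑ i, ∑ j, (swapDiff a b π i j : ℂ) * r (s * swapDiff a b π i j)
          - s * (V π - v : ℝ)) := by
    simp only [mul_assoc Complex.I]
    rw [← mul_expect, hstein, mul_expect, mul_expect, ← expect_add_distrib]
    refine expect_congr rfl fun π _ => ?_
    have h1 (i j : ι) : (swapDiff a b π i j : ℂ)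
        * (e (permStat a b π) - e (permStat a b π - swapDiff a b π i j))
        = e (permStat a b π) * ((swapDiff a b π i j : ℂ) * r (s * swapDiff a b π i j))
          + e (permStat a b π) * (Complex.I * s) * ((swapDiff a b π i j ^ 2 : ℝ) : ℂ) := by
      rw [hexp]
      simp only [hr]
      push_cast
      ring
    have h2 : (V π : ℂ) = (4 * Fintype.card ι : ℂ)⁻¹
        * ∑ i, ∑ j, ((swapDiff a b π i j ^ 2 : ℝ) : ℂ) := by
      simp only [hV]
      push_cast
      field_simp
    simp only [h1, sum_add_distrib, ← mul_sum]
    push_cast at h2 ⊢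
    rw [h2]
    linear_combination (e (permStat a b π) * s * (4 * Fintype.card ι : ℂ)⁻¹
        * ∑ i, ∑ j, (swapDiff a b π i j : ℂ) ^ 2) * Complex.I_mul_I
  have hbound (π : Equiv.Perm ι) : ‖e (permStat a b π) * (Complex.I * (4 * Fintype.card ι : ℂ)⁻¹
          * ∑ i, ∑ j, (swapDiff a b π i j : ℂ) * r (s * swapDiff a b π i j)
          - s * (V π - v : ℝ))‖ ≤ 32 * Fintype.card ι * κ ^ 3 + |V π - v| := by
    have he1 : ‖e (permStat a b π)‖ = 1 := Complex.norm_exp_I_mul_ofReal _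
    rw [norm_mul, he1, one_mul]
    refine (norm_sub_le _ _).trans (add_le_add ?_ ?_)
    · rw [norm_mul, norm_mul, Complex.norm_I, one_mul]
      have hterm (i j : ι) : ‖(swapDiff a b π i j : ℂ) * r (s * swapDiff a b π i j)‖
          ≤ 2 * (4 * κ) ^ 3 := by
        rw [norm_mul, Complex.norm_real, Real.norm_eq_abs]
        have h1 := abs_swapDiff_le hκ π i j
        have h2 := norm_one_sub_exp_sub_le (s * swapDiff a b π i j)
        have h3 : (s * swapDiff a b π i j) ^ 2 ≤ (4 * κ) ^ 2 := by
          rw [mul_pow, ← sq_abs (swapDiff a b π i j)]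
          have : s ^ 2 ≤ 1 := pow_le_one₀ hs0 hs1
          have := pow_le_pow_left₀ (abs_nonneg _) h1 2
          nlinarith [sq_nonneg |swapDiff a b π i j|]
        calc _ ≤ (4 * κ) * (2 * (4 * κ) ^ 2) :=
              mul_le_mul h1 (h2.trans (by linarith)) (norm_nonneg _) (by positivity)
          _ = _ := by ring
      have hsum : ‖∑ i, ∑ j, (swapDiff a b π i j : ℂ) * r (s * swapDiff a b π i j)‖
          ≤ (Fintype.card ι : ℝ) ^ 2 * (2 * (4 * κ) ^ 3) := by
        refine (norm_sum_le_of_le _ fun i _ => norm_sum_le_of_le _ fun j _ => hterm i j).trans ?_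
        simp only [sum_const, card_univ, nsmul_eq_mul]
        exact le_of_eq (by ring)
      have h4 : ‖(4 * Fintype.card ι : ℂ)⁻¹‖ = (4 * Fintype.card ι : ℝ)⁻¹ := by simp
      rw [h4]
      calc _ ≤ (4 * Fintype.card ι : ℝ)⁻¹ * ((Fintype.card ι : ℝ) ^ 2 * (2 * (4 * κ) ^ 3)) := by
            gcongr
        _ = _ := by field_simp; ring
    · rw [norm_mul, Complex.norm_real, Complex.norm_real, Real.norm_eq_abs, Real.norm_eq_abs,
        abs_of_nonneg hs0]
      nlinarith [abs_nonneg (V π - v)]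
  rw [hmain]
  refine (RCLike.norm_expect_le (K := ℂ)).trans ((expect_le_expect fun π _ => hbound π).trans ?_)
  rw [expect_add_distrib, Fintype.expect_const]
  gcongr
  exact expect_abs_sum_swapDiff_sq_le ha hb hn hκ

/-- Quantitative combinatorial central limit theorem for bounded arrays. -/
lemma norm_expect_exp_permStat_sub_le [DecidableEq ι] {a b : ι → ℝ} (ha : ∑ i, a i = 0)
    (hb : ∑ i, b i = 0) (hn : 2 ≤ Fintype.card ι) {κ : ℝ} (hκ : ∀ i j, |a i * b j| ≤ κ) :
    ‖𝔼 π, Complex.exp (Complex.I * permStat a b π)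
        - Real.exp (-((∑ i, a i ^ 2) * (∑ i, b i ^ 2) / Fintype.card ι) / 2)‖
      ≤ 32 * Fintype.card ι * κ ^ 3 + (√(Fintype.card ι) * κ ^ 2 + 2 * κ ^ 2) := by
  set v : ℝ := (∑ i, a i ^ 2) * (∑ i, b i ^ 2) / Fintype.card ι with hv
  have hv0 : 0 ≤ v := by positivity
  set ε : ℝ := 32 * Fintype.card ι * κ ^ 3 + (√(Fintype.card ι) * κ ^ 2 + 2 * κ ^ 2)
  set φ : ℝ → ℂ := fun s => 𝔼 π, Complex.exp (Complex.I * (s * permStat a b π : ℝ)) with hφ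
  set φ' : ℝ → ℂ := fun s => 𝔼 π, (Complex.I * permStat a b π
    * Complex.exp (Complex.I * (s * permStat a b π : ℝ)))
  have hderiv (s : ℝ) : HasDerivAt φ (φ' s) s := by
    simp only [φ, φ', Fintype.expect_eq_sum_div_card]
    refine HasDerivAt.div_const (HasDerivAt.fun_sum fun π _ => ?_) _
    have h1 : HasDerivAt (fun s : ℝ => Complex.I * ((s * permStat a b π : ℝ) : ℂ))
        (Complex.I * permStat a b π) s := by
      have := ((hasDerivAt_id s).mul_const (permStat a b π)).ofReal_comp.const_mul Complex.I
      simpa using this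
    rw [mul_comm]
    exact h1.cexp
  have hgauss (s : ℝ) : HasDerivAt (fun s : ℝ => ((Real.exp (v * s ^ 2 / 2) : ℝ) : ℂ))
      ((Real.exp (v * s ^ 2 / 2) * (v * s) : ℝ) : ℂ) s := by
    refine HasDerivAt.ofReal_comp (HasDerivAt.exp ?_)
    refine (((hasDerivAt_pow 2 s).const_mul v).div_const 2).congr_deriv ?_
    norm_num
    ring
  have hg := norm_image_sub_le_of_norm_deriv_le_segment_01'
    (C := ε * Real.exp (v / 2))
    (fun s _ => ((hderiv s).mul (hgauss s)).hasDerivWithinAt) fun s hs => by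
      have h1 := norm_expect_stein_le ha hb hn hκ hs.1 hs.2.le
      rw [← hv] at h1
      have h2 : φ' s * ((Real.exp (v * s ^ 2 / 2) : ℝ) : ℂ)
          + φ s * ((Real.exp (v * s ^ 2 / 2) * (v * s) : ℝ) : ℂ)
          = (φ' s + (v * s : ℝ) * φ s) * ((Real.exp (v * s ^ 2 / 2) : ℝ) : ℂ) := by
        push_cast; ring
      rw [h2, norm_mul, Complex.norm_real, Real.norm_of_nonneg (Real.exp_nonneg _)]
      refine mul_le_mul h1 (Real.exp_le_exp.2 ?_) (Real.exp_nonneg _) ((norm_nonneg _).trans h1)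
      have : s ^ 2 ≤ 1 := pow_le_one₀ hs.1 hs.2.le
      nlinarith
  have h0 : φ 0 = 1 := by simp [hφ]
  have h1 : φ 1 = 𝔼 π, Complex.exp (Complex.I * permStat a b π) := by simp [hφ]
  simp only [Pi.mul_apply, h0, h1] at hg
  have h3 : 𝔼 π, Complex.exp (Complex.I * permStat a b π) - Real.exp (-v / 2)
      = Real.exp (-v / 2) * ((𝔼 π, Complex.exp (Complex.I * permStat a b π))
        * (Real.exp (v * 1 ^ 2 / 2) : ℝ) - 1 * (Real.exp (v * 0 ^ 2 / 2) : ℝ)) := by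
    have h4 : (Real.exp (-v / 2) : ℂ) * (Real.exp (v / 2) : ℝ) = 1 := by
      rw [← Complex.ofReal_mul, ← Real.exp_add, neg_div, neg_add_cancel, Real.exp_zero,
        Complex.ofReal_one]
    simp only [one_pow, mul_one, ne_eq, OfNat.ofNat_ne_zero, not_false_eq_true, zero_pow, mul_zero,
      zero_div, Real.exp_zero, Complex.ofReal_one]
    linear_combination (-𝔼 π, Complex.exp (Complex.I * permStat a b π)) * h4
  rw [h3, norm_mul, Complex.norm_real, Real.norm_of_nonneg (Real.exp_nonneg _)]
  calc _ ≤ Real.exp (-v / 2) * (ε * Real.exp (v / 2)) := by gcongr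
    _ = ε := by
      rw [mul_left_comm, ← Real.exp_add, neg_div, neg_add_cancel, Real.exp_zero, mul_one]

/-- Truncation at level `M`, followed by recentering. -/
noncomputable def truncCentered (a : ι → ℝ) (M : ℝ) (i : ι) : ℝ :=
  (if |a i| ≤ M then a i else 0) - (∑ j, if |a j| ≤ M then a j else 0) / Fintype.card ι

lemma sum_truncCentered [Nonempty ι] (a : ι → ℝ) (M : ℝ) : ∑ i, truncCentered a M i = 0 :=
  sum_sub_mean _

lemma abs_truncCentered_le [Nonempty ι] (a : ι → ℝ) {M : ℝ} (hM : 0 ≤ M) (i : ι) :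
    |truncCentered a M i| ≤ 2 * M := by
  have hn : (0 : ℝ) < Fintype.card ι := by simp [Fintype.card_pos]
  have h (j : ι) : |if |a j| ≤ M then a j else 0| ≤ M := by
    split_ifs with hj
    · exact hj
    · simpa
  have hmean : |(∑ j, if |a j| ≤ M then a j else 0) / Fintype.card ι| ≤ M := by
    rw [abs_div, abs_of_pos hn, div_le_iff₀ hn]
    refine (abs_sum_le_sum_abs _ _).trans ((sum_le_sum fun j _ => h j).trans ?_)
    simp [mul_comm]
  exact (abs_sub _ _).trans (by linarith [h i])

lemma sum_sub_truncCentered_sq_le [Nonempty ι] {a : ι → ℝ} (ha : ∑ i, a i = 0) {M δ : ℝ}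
    (hM : 0 < M) (hδ : 0 < δ) :
    ∑ i, (a i - truncCentered a M i) ^ 2 ≤ M ^ (-δ) * ∑ i, |a i| ^ (2 + δ) := by
  set t : ι → ℝ := fun i => if |a i| ≤ M then a i else 0 with ht
  have h1 (i : ι) : a i - truncCentered a M i
      = (a i - t i) - (∑ j, (a j - t j)) / Fintype.card ι := by
    rw [sum_sub_distrib, ha]
    simp only [truncCentered, ht]
    ring
  simp only [h1]
  refine (sum_sub_mean_sq_le fun i => a i - t i).trans ?_
  rw [mul_sum]
  refine sum_le_sum fun i _ => ?_
  simp only [ht]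
  split_ifs with hi
  · simp only [sub_self, ne_eq, OfNat.ofNat_ne_zero, not_false_eq_true, zero_pow]
    positivity
  · have hi' : M < |a i| := not_le.1 hi
    have hpos : 0 < |a i| := hM.trans hi'
    rw [sub_zero, Real.rpow_add hpos, Real.rpow_two, sq_abs, Real.rpow_neg hM.le,
      mul_left_comm, ← div_eq_inv_mul]
    refine le_mul_of_one_le_right (sq_nonneg _) ?_
    rw [one_le_div (Real.rpow_pos_of_pos hM _)]
    exact Real.rpow_le_rpow hM.le hi'.le hδ.le

lemma expect_abs_permStat_le [DecidableEq ι] {a b : ι → ℝ} (ha : ∑ i, a i = 0)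
    (hb : ∑ i, b i = 0) (hn : 2 ≤ Fintype.card ι) :
    (Fintype.card ι : ℝ) ^ (-(1 / 2 : ℝ)) * 𝔼 π, |permStat a b π|
      ≤ √(2 * ((Fintype.card ι : ℝ)⁻¹ * ∑ i, a i ^ 2)
          * ((Fintype.card ι : ℝ)⁻¹ * ∑ i, b i ^ 2)) := by
  have hn' : (0 : ℝ) < Fintype.card ι := by exact_mod_cast (by omega : 0 < Fintype.card ι)
  have h1 : (Fintype.card ι : ℝ) ^ (-(1 / 2 : ℝ)) = √((Fintype.card ι : ℝ)⁻¹) := by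
    rw [Real.sqrt_inv, Real.sqrt_eq_rpow, Real.rpow_neg hn'.le]
  rw [h1]
  calc _ ≤ √((Fintype.card ι : ℝ)⁻¹)
        * √(2 * ((∑ i, a i ^ 2) * ∑ i, b i ^ 2) / Fintype.card ι) := by
        gcongr
        exact (expect_abs_le_sqrt _).trans
          (Real.sqrt_le_sqrt (expect_permStat_sq_le ha hb hn))
    _ = _ := by
        rw [← Real.sqrt_mul (by positivity)]
        congr 1
        field_simp

/-- Two nearby pairs of arrays give nearby characteristic functions of `permStat`. -/
lemma norm_expect_exp_permStat_sub_expect_le [DecidableEq ι] {a b a' b' : ι → ℝ}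
    (ha : ∑ i, a i = 0) (hb : ∑ i, b i = 0) (ha' : ∑ i, a' i = 0) (hb' : ∑ i, b' i = 0)
    (hn : 2 ≤ Fintype.card ι) :
    ‖𝔼 π, Complex.exp (Complex.I * ((Fintype.card ι : ℝ) ^ (-(1 / 2 : ℝ)) * permStat a b π : ℝ))
        - 𝔼 π, Complex.exp
            (Complex.I * ((Fintype.card ι : ℝ) ^ (-(1 / 2 : ℝ)) * permStat a' b' π : ℝ))‖
      ≤ √(2 * ((Fintype.card ι : ℝ)⁻¹ * ∑ i, (a i - a' i) ^ 2)
          * ((Fintype.card ι : ℝ)⁻¹ * ∑ i, b i ^ 2))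
        + √(2 * ((Fintype.card ι : ℝ)⁻¹ * ∑ i, a' i ^ 2)
          * ((Fintype.card ι : ℝ)⁻¹ * ∑ i, (b i - b' i) ^ 2)) := by
  have hn' : (0 : ℝ) < Fintype.card ι := by exact_mod_cast (by omega : 0 < Fintype.card ι)
  set c : ℝ := (Fintype.card ι : ℝ) ^ (-(1 / 2 : ℝ))
  have hc : 0 ≤ c := by positivity
  have hdiff (π : Equiv.Perm ι) : permStat a b π - permStat a' b' π
      = permStat (fun i => a i - a' i) b π + permStat a' (fun i => b i - b' i) π := by
    simp only [permStat, ← sum_sub_distrib, ← sum_add_distrib]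
    exact sum_congr rfl fun i _ => by ring
  have hexp (x y : ℝ) :
      ‖Complex.exp (Complex.I * x) - Complex.exp (Complex.I * y)‖ ≤ |x - y| := by
    have h : Complex.exp (Complex.I * x) - Complex.exp (Complex.I * y)
        = Complex.exp (Complex.I * y) * (Complex.exp (Complex.I * (x - y : ℝ)) - 1) := by
      rw [mul_sub, ← Complex.exp_add, mul_one]
      congr 2
      push_cast
      ring
    rw [h, norm_mul, Complex.norm_exp_I_mul_ofReal, one_mul]
    exact Real.norm_exp_I_mul_ofReal_sub_one_le
  rw [← expect_sub_distrib]
  calc _ ≤ 𝔼 π, (c * |permStat (fun i => a i - a' i) b π|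
          + c * |permStat a' (fun i => b i - b' i) π|) := by
        refine (RCLike.norm_expect_le (K := ℂ)).trans (expect_le_expect fun π _ => ?_)
        refine (hexp _ _).trans ?_
        rw [← mul_sub, hdiff, abs_mul, abs_of_nonneg hc, ← mul_add]
        gcongr
        exact abs_add_le _ _
    _ ≤ _ := by
        rw [expect_add_distrib, ← mul_expect, ← mul_expect]
        exact add_le_add
          (expect_abs_permStat_le (by simp [sum_sub_distrib, ha, ha']) hb hn)
          (expect_abs_permStat_le ha' (by simp [sum_sub_distrib, hb, hb']) hn)

end PermutationStatistic

section Asymptotics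

open scoped BigOperators

/-- The truncation level used for arrays of length `n`. -/
noncomputable def truncLevel (n : ℕ) : ℝ := (n : ℝ) ^ (1 / 20 : ℝ)

lemma tendsto_natCast_rpow_neg {r : ℝ} (hr : r < 0) :
    Tendsto (fun n : ℕ => (n : ℝ) ^ r) atTop (nhds 0) := by
  have := (tendsto_rpow_neg_atTop (neg_pos.2 hr)).comp (tendsto_natCast_atTop_atTop (R := ℝ))
  simpa [Function.comp_def] using this

variable {δ : ℝ} {a : (n : ℕ) → Fin n → ℝ} {α C : ℝ}

lemma tendsto_mean_sub_truncCentered_sq (hδ : 0 < δ) (ha : ∀ n, ∑ i, a n i = 0)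
    (hC : ∀ n : ℕ, 0 < n → (n : ℝ)⁻¹ * ∑ i, |a n i| ^ (2 + δ) ≤ C) :
    Tendsto (fun n : ℕ => (n : ℝ)⁻¹ * ∑ i, (a n i - truncCentered (a n) (truncLevel n) i) ^ 2)
      atTop (nhds 0) := by
  have hlim : Tendsto (fun n : ℕ => (n : ℝ) ^ (-(1 / 20 * δ)) * C) atTop (nhds 0) := by
    simpa using (tendsto_natCast_rpow_neg (by linarith : -(1 / 20 * δ) < 0)).mul_const C
  refine squeeze_zero' (.of_forall fun n => by positivity) ?_ hlim
  filter_upwards [eventually_gt_atTop 0] with n hn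
  have hn' : (0 : ℝ) < n := by exact_mod_cast hn
  have : Nonempty (Fin n) := ⟨⟨0, hn⟩⟩
  have hM : 0 < truncLevel n := Real.rpow_pos_of_pos hn' _
  have hMδ : truncLevel n ^ (-δ) = (n : ℝ) ^ (-(1 / 20 * δ)) := by
    rw [truncLevel, ← Real.rpow_mul hn'.le, mul_neg]
  calc _ ≤ (n : ℝ)⁻¹ * (truncLevel n ^ (-δ) * ∑ i, |a n i| ^ (2 + δ)) := by
        gcongr
        exact sum_sub_truncCentered_sq_le (ha n) hM hδ
    _ = (n : ℝ) ^ (-(1 / 20 * δ)) * ((n : ℝ)⁻¹ * ∑ i, |a n i| ^ (2 + δ)) := by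
        rw [hMδ]; ring
    _ ≤ _ := by
        gcongr
        exact hC n hn

lemma tendsto_mean_truncCentered_sq (hδ : 0 < δ) (ha : ∀ n, ∑ i, a n i = 0)
    (hα : Tendsto (fun n : ℕ => (n : ℝ)⁻¹ * ∑ i, a n i ^ 2) atTop (nhds α))
    (hC : ∀ n : ℕ, 0 < n → (n : ℝ)⁻¹ * ∑ i, |a n i| ^ (2 + δ) ≤ C) :
    Tendsto (fun n : ℕ => (n : ℝ)⁻¹ * ∑ i, truncCentered (a n) (truncLevel n) i ^ 2)
      atTop (nhds α) := by
  have hm := tendsto_mean_sub_truncCentered_sq hδ ha hC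
  have hcross : Tendsto (fun n : ℕ => (n : ℝ)⁻¹
      * ∑ i, a n i * (a n i - truncCentered (a n) (truncLevel n) i)) atTop (nhds 0) := by
    have hlim := (hα.mul hm).sqrt
    rw [mul_zero, Real.sqrt_zero] at hlim
    refine squeeze_zero_norm (fun n => Real.abs_le_sqrt ?_) hlim
    have := sum_mul_sq_le_sq_mul_sq univ (a n)
      (fun i => a n i - truncCentered (a n) (truncLevel n) i)
    calc _ = (n : ℝ)⁻¹ ^ 2
          * (∑ i, a n i * (a n i - truncCentered (a n) (truncLevel n) i)) ^ 2 := mul_pow _ _ _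
      _ ≤ (n : ℝ)⁻¹ ^ 2 * ((∑ i, a n i ^ 2)
          * ∑ i, (a n i - truncCentered (a n) (truncLevel n) i) ^ 2) := by gcongr
      _ = _ := by ring
  have h := (hα.sub (hcross.const_mul 2)).add hm
  simp only [mul_zero, sub_zero, add_zero] at h
  refine h.congr fun n => ?_
  rw [mul_left_comm, ← mul_sub, ← mul_add, mul_sum, ← sum_sub_distrib, ← sum_add_distrib]
  congr 1
  exact sum_congr rfl fun i _ => by ring

/-- Combinatorial central limit theorem for scalar arrays, at the level of characteristic
functions. -/
theorem tendsto_expect_exp_permStat {b : (n : ℕ) → Fin n → ℝ} {β D : ℝ} (hδ : 0 < δ)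
    (ha : ∀ n, ∑ i, a n i = 0) (hb : ∀ n, ∑ i, b n i = 0)
    (hα : Tendsto (fun n : ℕ => (n : ℝ)⁻¹ * ∑ i, a n i ^ 2) atTop (nhds α))
    (hβ : Tendsto (fun n : ℕ => (n : ℝ)⁻¹ * ∑ i, b n i ^ 2) atTop (nhds β))
    (hC : ∀ n : ℕ, 0 < n → (n : ℝ)⁻¹ * ∑ i, |a n i| ^ (2 + δ) ≤ C)
    (hD : ∀ n : ℕ, 0 < n → (n : ℝ)⁻¹ * ∑ i, |b n i| ^ (2 + δ) ≤ D) :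
    Tendsto (fun n : ℕ => 𝔼 π, Complex.exp
        (Complex.I * ((n : ℝ) ^ (-(1 / 2 : ℝ)) * permStat (a n) (b n) π : ℝ)))
      atTop (nhds (Real.exp (-(α * β) / 2) : ℝ)) := by
  set a' : (n : ℕ) → Fin n → ℝ := fun n => truncCentered (a n) (truncLevel n) with ha'
  set b' : (n : ℕ) → Fin n → ℝ := fun n => truncCentered (b n) (truncLevel n) with hb'
  set A : ℕ → ℝ := fun n => (n : ℝ)⁻¹ * ∑ i, a' n i ^ 2 with hA
  set B : ℕ → ℝ := fun n => (n : ℝ)⁻¹ * ∑ i, b' n i ^ 2 with hB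
  have hAlim : Tendsto A atTop (nhds α) := tendsto_mean_truncCentered_sq hδ ha hα hC
  have hBlim : Tendsto B atTop (nhds β) := tendsto_mean_truncCentered_sq hδ hb hβ hD
  have htrunc : Tendsto (fun n : ℕ => 𝔼 π, Complex.exp
        (Complex.I * ((n : ℝ) ^ (-(1 / 2 : ℝ)) * permStat (a n) (b n) π : ℝ))
      - 𝔼 π, Complex.exp
        (Complex.I * ((n : ℝ) ^ (-(1 / 2 : ℝ)) * permStat (a' n) (b' n) π : ℝ)))
      atTop (nhds 0) := by
    have h1 := (((tendsto_mean_sub_truncCentered_sq hδ ha hC).const_mul 2).mul hβ).sqrt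
    have h2 := ((hAlim.const_mul 2).mul (tendsto_mean_sub_truncCentered_sq hδ hb hD)).sqrt
    have h3 := h1.add h2
    simp only [mul_zero, zero_mul, Real.sqrt_zero, add_zero] at h3
    refine squeeze_zero_norm' ?_ h3
    filter_upwards [eventually_ge_atTop 2] with n hn
    have : Nonempty (Fin n) := ⟨⟨0, by omega⟩⟩
    simpa using norm_expect_exp_permStat_sub_expect_le (ha n) (hb n)
      (sum_truncCentered (a n) (truncLevel n)) (sum_truncCentered (b n) (truncLevel n))
      (by simpa using hn)
  have hstein : Tendsto (fun n : ℕ => 𝔼 π, Complex.exp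
        (Complex.I * ((n : ℝ) ^ (-(1 / 2 : ℝ)) * permStat (a' n) (b' n) π : ℝ))
      - Real.exp (-(A n * B n) / 2)) atTop (nhds 0) := by
    have h1 : Tendsto (fun n : ℕ => 2048 * (n : ℝ) ^ (-(1 / 5) : ℝ)
        + (16 * (n : ℝ) ^ (-(3 / 10) : ℝ) + 32 * (n : ℝ) ^ (-(4 / 5) : ℝ))) atTop (nhds 0) := by
      simpa using ((tendsto_natCast_rpow_neg (by norm_num : (-(1 / 5) : ℝ) < 0)).const_mul 2048).add
        (((tendsto_natCast_rpow_neg (by norm_num : (-(3 / 10) : ℝ) < 0)).const_mul 16).add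
        ((tendsto_natCast_rpow_neg (by norm_num : (-(4 / 5) : ℝ) < 0)).const_mul 32))
    refine squeeze_zero_norm' ?_ h1
    filter_upwards [eventually_ge_atTop 2] with n hn
    have : Nonempty (Fin n) := ⟨⟨0, by omega⟩⟩
    have hn' : (0 : ℝ) < n := by exact_mod_cast (by omega : 0 < n)
    have hM : 0 ≤ truncLevel n := Real.rpow_nonneg hn'.le _
    have hκ (i j : Fin n) : |(n : ℝ) ^ (-(1 / 2 : ℝ)) * a' n i * b' n j|
        ≤ 4 * (n : ℝ) ^ (-(2 / 5) : ℝ) := by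
      have e1 : (n : ℝ) ^ (-(2 / 5) : ℝ)
          = (n : ℝ) ^ (-(1 / 2 : ℝ)) * (truncLevel n * truncLevel n) := by
        rw [truncLevel, ← Real.rpow_add hn', ← Real.rpow_add hn']
        norm_num
      rw [e1, abs_mul, abs_mul, abs_of_nonneg (Real.rpow_nonneg hn'.le _), mul_assoc]
      calc _ ≤ (n : ℝ) ^ (-(1 / 2 : ℝ)) * ((2 * truncLevel n) * (2 * truncLevel n)) := by
            gcongr
            · exact abs_truncCentered_le _ hM _
            · exact abs_truncCentered_le _ hM _
        _ = _ := by ring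
    have hmain := norm_expect_exp_permStat_sub_le
      (a := fun i => (n : ℝ) ^ (-(1 / 2 : ℝ)) * a' n i) (b := b' n)
      (by rw [← mul_sum, sum_truncCentered, mul_zero]) (sum_truncCentered _ _)
      (by simpa using hn) hκ
    have e2 (π : Equiv.Perm (Fin n)) :
        permStat (fun i => (n : ℝ) ^ (-(1 / 2 : ℝ)) * a' n i) (b' n) π
          = (n : ℝ) ^ (-(1 / 2 : ℝ)) * permStat (a' n) (b' n) π := by
      simp only [permStat, mul_sum, mul_assoc]
    have e3 : ((n : ℝ) ^ (-(1 / 2 : ℝ))) ^ 2 = (n : ℝ)⁻¹ := by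
      rw [← Real.rpow_natCast, ← Real.rpow_mul hn'.le, ← Real.rpow_neg_one]
      norm_num
    have e4 : (∑ i, ((n : ℝ) ^ (-(1 / 2 : ℝ)) * a' n i) ^ 2) * (∑ i, b' n i ^ 2) / n
        = A n * B n := by
      simp only [mul_pow, e3, ← mul_sum, hA, hB]
      ring
    have e5 : 32 * (n : ℝ) * (4 * (n : ℝ) ^ (-(2 / 5) : ℝ)) ^ 3
        = 2048 * (n : ℝ) ^ (-(1 / 5) : ℝ) := by
      have : (n : ℝ) ^ (-(1 / 5) : ℝ) = n * ((n : ℝ) ^ (-(2 / 5) : ℝ)) ^ 3 := by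
        nth_rewrite 2 [← Real.rpow_one (n : ℝ)]
        rw [← Real.rpow_natCast, ← Real.rpow_mul hn'.le, ← Real.rpow_add hn']
        norm_num
      rw [this]; ring
    have e6 : (4 * (n : ℝ) ^ (-(2 / 5) : ℝ)) ^ 2 = 16 * (n : ℝ) ^ (-(4 / 5) : ℝ) := by
      rw [mul_pow, ← Real.rpow_natCast, ← Real.rpow_natCast, ← Real.rpow_mul hn'.le]
      norm_num
    have e7 : √(n : ℝ) * (16 * (n : ℝ) ^ (-(4 / 5) : ℝ)) = 16 * (n : ℝ) ^ (-(3 / 10) : ℝ) := by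
      rw [mul_left_comm, Real.sqrt_eq_rpow, ← Real.rpow_add hn']
      norm_num
    simp only [e2, Fintype.card_fin, e4, e5, e6, e7] at hmain
    refine hmain.trans (le_of_eq ?_)
    ring
  have hexp : Tendsto (fun n => ((Real.exp (-(A n * B n) / 2) : ℝ) : ℂ)) atTop
      (nhds (Real.exp (-(α * β) / 2) : ℝ)) :=
    (Complex.continuous_ofReal.tendsto _).comp
      ((Real.continuous_exp.tendsto _).comp ((hAlim.mul hBlim).neg.div_const 2))
  have h := (htrunc.add hstein).add hexp
  simp only [zero_add] at h
  refine h.congr fun n => ?_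
  ring

end Asymptotics

section WeakConvergence

/-- The law of `Y` under the uniform distribution on a finite type. -/
noncomputable def uniformLaw {Ω E : Type*} [Fintype Ω] [Nonempty Ω] [MeasurableSpace E]
    (Y : Ω → E) : ProbabilityMeasure E :=
  letI : MeasurableSpace Ω := ⊤
  ⟨(PMF.uniformOfFintype Ω).toMeasure.map Y,
    Measure.isProbabilityMeasure_map measurable_from_top.aemeasurable⟩

lemma integral_uniformLaw {Ω E G : Type*} [Fintype Ω] [Nonempty Ω] [MeasurableSpace E]
    [NormedAddCommGroup G] [NormedSpace ℝ G] [CompleteSpace G] (Y : Ω → E) {F : E → G}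
    (hF : StronglyMeasurable F) :
    ∫ y, F y ∂(uniformLaw Y : Measure E) = (Fintype.card Ω : ℝ)⁻¹ • ∑ ω, F (Y ω) := by
  let _ : MeasurableSpace Ω := ⊤
  have : (uniformLaw Y : Measure E) = (PMF.uniformOfFintype Ω).toMeasure.map Y := rfl
  rw [this, integral_map measurable_from_top.aemeasurable hF.aestronglyMeasurable,
    PMF.integral_eq_sum, smul_sum]
  simp

/-- The law of `R g` on Euclidean space, for a standard Gaussian vector `g`. -/
noncomputable def gaussianLaw {k : ℕ} (R : Matrix (Fin k) (Fin k) ℝ) :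
    Measure (EuclideanSpace ℝ (Fin k)) :=
  (stdGaussianPi k).map fun g => WithLp.toLp 2 (R.mulVec g)

lemma continuous_toLp_mulVec {k : ℕ} (R : Matrix (Fin k) (Fin k) ℝ) :
    Continuous fun g : Fin k → ℝ => WithLp.toLp 2 (R.mulVec g) :=
  (PiLp.continuous_toLp 2 _).comp (by fun_prop)

instance instIsProbabilityMeasureStdGaussianPi {k : ℕ} :
    IsProbabilityMeasure (stdGaussianPi k) := by
  unfold stdGaussianPi; infer_instance

instance instIsProbabilityMeasureGaussianLaw {k : ℕ} (R : Matrix (Fin k) (Fin k) ℝ) :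
    IsProbabilityMeasure (gaussianLaw R) :=
  Measure.isProbabilityMeasure_map (continuous_toLp_mulVec R).aemeasurable

lemma charFun_gaussianLaw {k : ℕ} (R : Matrix (Fin k) (Fin k) ℝ)
    (u : EuclideanSpace ℝ (Fin k)) :
    charFun (gaussianLaw R) u
      = (Real.exp (-(u.ofLp ⬝ᵥ (R * Rᵀ).mulVec u.ofLp) / 2) : ℝ) := by
  have hinner (g : Fin k → ℝ) : inner ℝ (WithLp.toLp 2 (R.mulVec g)) u
      = inner ℝ (WithLp.toLp 2 g) (WithLp.toLp 2 (Rᵀ.mulVec u.ofLp)) := by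
    simp only [EuclideanSpace.inner_eq_star_dotProduct, star_trivial]
    rw [dotProduct_mulVec, mulVec_transpose]
  have h := charFun_pi (μ := fun _ : Fin k => gaussianReal 0 1)
    (WithLp.toLp 2 (Rᵀ.mulVec u.ofLp))
  rw [charFun_apply, integral_map (PiLp.continuous_toLp 2 _).aemeasurable
    (by fun_prop)] at h
  rw [charFun_apply, gaussianLaw, integral_map (continuous_toLp_mulVec R).aemeasurable
    (by fun_prop)]
  simp only [hinner]
  rw [stdGaussianPi, h]
  simp only [charFun_gaussianReal, ← Complex.exp_sum]
  rw [← Matrix.mulVec_mulVec, dotProduct_mulVec, ← mulVec_transpose, Complex.ofReal_exp]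
  congr 1
  simp [dotProduct, neg_div, sum_div, pow_two]

end WeakConvergence

/-- Permutation CLT for vector statistics: for centered triangular arrays `x` (in `ℝ^k`)
and `w` (scalars) with second-moment limits `Q` (positive definite) and `σ² > 0` and
bounded `(2+δ)`-moment averages, the permutation law of `n^{-1/2} ∑ᵢ xᵢ w_{π(i)}`
converges weakly to `N(0, σ²Q)` (realized as the pushforward of a standard Gaussian by
any `R` with `RR' = σ²Q`). -/
theorem stmt17 (k : ℕ) (δ σ2 : ℝ) (hδ : 0 < δ) (hσ : 0 < σ2)
    (x : (n : ℕ) → Fin n → Fin k → ℝ) (w : (n : ℕ) → Fin n → ℝ)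
    (Q : Matrix (Fin k) (Fin k) ℝ) (hQ : Q.PosDef)
    (hxc : ∀ n t, ∑ i, x n i t = 0) (hwc : ∀ n, ∑ i, w n i = 0)
    (hQconv : ∀ t s : Fin k,
      Tendsto (fun n : ℕ => (n : ℝ)⁻¹ * ∑ i, x n i t * x n i s) atTop (nhds (Q t s)))
    (hwconv : Tendsto (fun n : ℕ => (n : ℝ)⁻¹ * ∑ i, (w n i) ^ 2) atTop (nhds σ2))
    (C : ℝ)
    (hxm : ∀ n : ℕ, 0 < n →
      (n : ℝ)⁻¹ * ∑ i, (Real.sqrt (∑ t, (x n i t) ^ 2)) ^ (2 + δ) ≤ C)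
    (hwm : ∀ n : ℕ, 0 < n → (n : ℝ)⁻¹ * ∑ i, |w n i| ^ (2 + δ) ≤ C)
    (R : Matrix (Fin k) (Fin k) ℝ) (hR : R * Rᵀ = σ2 • Q) :
    ∀ f : BoundedContinuousFunction (Fin k → ℝ) ℝ,
      Tendsto (fun n : ℕ => ((Nat.factorial n : ℝ))⁻¹ *
          ∑ π : Equiv.Perm (Fin n),
            f (fun t => ((n : ℝ) ^ (-(1 / 2 : ℝ))) * ∑ i, x n i t * w n (π i)))
        atTop
        (nhds (∫ y, f y ∂(Measure.map (fun g : Fin k → ℝ => R.mulVec g) (stdGaussianPi k)))) := by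
  intro f
  set Y : (n : ℕ) → Equiv.Perm (Fin n) → EuclideanSpace ℝ (Fin k) := fun n π =>
    WithLp.toLp 2 fun t => (n : ℝ) ^ (-(1 / 2 : ℝ)) * ∑ i, x n i t * w n (π i) with hY
  have hchar (u : EuclideanSpace ℝ (Fin k)) :
      Tendsto (fun n => charFun (uniformLaw (Y n) : Measure (EuclideanSpace ℝ (Fin k))) u) atTop
        (nhds (charFun (gaussianLaw R) u)) := by
    set a : (n : ℕ) → Fin n → ℝ := fun n i => u.ofLp ⬝ᵥ x n i with ha
    have hac (n : ℕ) : ∑ i, a n i = 0 := by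
      simp only [ha, dotProduct]
      rw [sum_comm]
      simp only [← mul_sum, hxc, mul_zero, sum_const_zero]
    have ha2 : Tendsto (fun n : ℕ => (n : ℝ)⁻¹ * ∑ i, a n i ^ 2) atTop
        (nhds (u.ofLp ⬝ᵥ Q.mulVec u.ofLp)) := by
      have h : Tendsto (fun n : ℕ => ∑ t, ∑ s, u.ofLp t * u.ofLp s
          * ((n : ℝ)⁻¹ * ∑ i, x n i t * x n i s)) atTop
          (nhds (∑ t, ∑ s, u.ofLp t * u.ofLp s * Q t s)) :=
        tendsto_finsetSum _ fun t _ => tendsto_finsetSum _ fun s _ => (hQconv t s).const_mul _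
      have hlim : ∑ t, ∑ s, u.ofLp t * u.ofLp s * Q t s = u.ofLp ⬝ᵥ Q.mulVec u.ofLp := by
        simp only [dotProduct, mulVec, mul_sum]
        exact sum_congr rfl fun t _ => sum_congr rfl fun s _ => by ring
      rw [← hlim]
      refine h.congr fun n => ?_
      simp only [ha, dotProduct, pow_two, sum_mul_sum]
      simp only [mul_sum]
      conv_rhs => rw [sum_comm]
      refine sum_congr rfl fun t _ => ?_
      rw [sum_comm]
      exact sum_congr rfl fun i _ => sum_congr rfl fun s _ => by ring
    have ham (n : ℕ) (hn : 0 < n) :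
        (n : ℝ)⁻¹ * ∑ i, |a n i| ^ (2 + δ) ≤ ‖u‖ ^ (2 + δ) * C := by
      have hle (i : Fin n) : |a n i| ^ (2 + δ)
          ≤ ‖u‖ ^ (2 + δ) * √(∑ t, x n i t ^ 2) ^ (2 + δ) := by
        rw [← Real.mul_rpow (norm_nonneg _) (Real.sqrt_nonneg _)]
        refine Real.rpow_le_rpow (abs_nonneg _) ?_ (by linarith)
        have h := abs_real_inner_le_norm (WithLp.toLp 2 (x n i)) u
        rw [EuclideanSpace.inner_eq_star_dotProduct, EuclideanSpace.norm_eq (WithLp.toLp 2 _),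
          mul_comm] at h
        simpa [ha] using h
      calc _ ≤ (n : ℝ)⁻¹ * ∑ i, ‖u‖ ^ (2 + δ) * √(∑ t, x n i t ^ 2) ^ (2 + δ) := by
            gcongr with i
            exact hle i
        _ = ‖u‖ ^ (2 + δ) * ((n : ℝ)⁻¹ * ∑ i, √(∑ t, x n i t ^ 2) ^ (2 + δ)) := by
            rw [← mul_sum, mul_left_comm]
        _ ≤ _ := by
            gcongr
            exact hxm n hn
    have hclt := tendsto_expect_exp_permStat hδ hac hwc ha2 hwconv ham hwm
    have hvar : u.ofLp ⬝ᵥ (R * Rᵀ).mulVec u.ofLp = (u.ofLp ⬝ᵥ Q.mulVec u.ofLp) * σ2 := by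
      rw [hR, smul_mulVec, dotProduct_smul, smul_eq_mul, mul_comm]
    rw [charFun_gaussianLaw, hvar]
    refine hclt.congr fun n => ?_
    rw [charFun_apply, integral_uniformLaw _ (Continuous.stronglyMeasurable (by fun_prop)),
      Fintype.expect_eq_sum_div_card, Complex.real_smul, div_eq_inv_mul]
    push_cast
    congr 1
    refine sum_congr rfl fun π _ => ?_
    have hinner : inner ℝ (Y n π) u = (n : ℝ) ^ (-(1 / 2 : ℝ)) * permStat (a n) (w n) π := by
      simp only [hY, EuclideanSpace.inner_eq_star_dotProduct, star_trivial, permStat, ha,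
        dotProduct, mul_sum, sum_mul]
      rw [sum_comm]
      exact sum_congr rfl fun i _ => sum_congr rfl fun t _ => by ring
    rw [hinner, mul_comm Complex.I]
    push_cast
    rfl
  have hlevy : Tendsto (fun n => uniformLaw (Y n)) atTop
      (nhds (⟨gaussianLaw R, inferInstance⟩ : ProbabilityMeasure (EuclideanSpace ℝ (Fin k)))) :=
    ProbabilityMeasure.tendsto_of_tendsto_charFun hchar
  have hcont : Continuous (WithLp.ofLp : EuclideanSpace ℝ (Fin k) → Fin k → ℝ) :=
    PiLp.continuous_ofLp 2 _
  have hf := ProbabilityMeasure.tendsto_iff_forall_integral_tendsto.1 hlevy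
    (f.compContinuous ⟨_, hcont⟩)
  have hlim : ∫ y, f y ∂(Measure.map (fun g : Fin k → ℝ => R.mulVec g) (stdGaussianPi k))
      = ∫ y, f (WithLp.ofLp y) ∂(gaussianLaw R) := by
    have h2 : ∫ y, f (WithLp.ofLp y) ∂(gaussianLaw R) = ∫ g, f (R.mulVec g) ∂(stdGaussianPi k) :=
      integral_map (continuous_toLp_mulVec R).aemeasurable
        (f.continuous.comp hcont).aestronglyMeasurable
    rw [h2]
    exact integral_map (Continuous.aemeasurable (by fun_prop)) f.continuous.aestronglyMeasurable
  rw [hlim]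
  refine hf.congr fun n => ?_
  rw [integral_uniformLaw _ (BoundedContinuousFunction.continuous _).stronglyMeasurable]
  simp [hY, Fintype.card_perm]
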